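/- Let x, z, t be elements of A satisfying x·z = q·z·x, z·t = q·t·z and x·t = q·t·x + λ·z². Then for every natural number n, (x + t)^n = Σ_{i=0}^{n} Σ_{m=0}^{⌊i/2⌋} C(n,i)_q · C(i, i−2m)_q · ν(2m) · t^{i−2m} · z^{2m} · x^{n−i}, where ν is the recursion with b = 0. -/

import Mathlib

/-- The q-integer `(n)_q = 1 + q + ⋯ + q^(n-1)`. -/
def qInt {k : Type*} [Field k] (q : k) (n : ℕ) : k := ∑ i ∈ Finset.range n, q ^ i

/-- The Gaussian (q-)binomial coefficient `C(n,i)_q`, defined via the q-Pascal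
recursion; it vanishes when `i > n`. -/
def qBinom {k : Type*} [Field k] (q : k) : ℕ → ℕ → k
  | _, 0 => 1
  | 0, _ + 1 => 0
  | n + 1, i + 1 => qBinom q n i + q ^ (i + 1) * qBinom q n (i + 1)

/-- The recursion `ν(0)=1, ν(1)=b, ν(n)=b·ν(n-1)+λ·(n-1)_q·ν(n-2)` with `b = 0`. -/
def nuSeq₀ {k : Type*} [Field k] (q lam : k) : ℕ → k
  | 0 => 1
  | 1 => 0
  | n + 2 => lam * qInt q (n + 1) * nuSeq₀ q lam n

section Scalars

variable {k : Type*} [Field k] (q : k)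

lemma qInt_add (a b : ℕ) : qInt q (a + b) = qInt q a + q ^ a * qInt q b := by
  simp [qInt, Finset.sum_range_add, Finset.mul_sum, pow_add]

lemma qInt_zero : qInt q 0 = 0 := by simp [qInt]

lemma qInt_one : qInt q 1 = 1 := by simp [qInt]

lemma one_sub_mul_qInt (n : ℕ) : (1 - q) * qInt q n = 1 - q ^ n :=
  mul_neg_geom_sum q n

lemma qBinom_zero_right (n : ℕ) : qBinom q n 0 = 1 := by
  cases n <;> rfl

lemma qBinom_succ_succ (n i : ℕ) :
    qBinom q (n + 1) (i + 1) = qBinom q n i + q ^ (i + 1) * qBinom q n (i + 1) := rfl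

lemma qBinom_eq_zero_of_lt {n i : ℕ} (h : n < i) : qBinom q n i = 0 := by
  induction n generalizing i with
  | zero =>
    obtain ⟨j, rfl⟩ := Nat.exists_eq_add_of_lt h
    simp [qBinom]
  | succ n ih =>
    obtain ⟨j, rfl⟩ : ∃ j, i = j + 1 := ⟨i - 1, by omega⟩
    rw [qBinom_succ_succ, ih (by omega), ih (by omega)]
    simp

lemma qBinom_self (n : ℕ) : qBinom q n n = 1 := by
  induction n with
  | zero => rfl
  | succ n ih => rw [qBinom_succ_succ, ih, qBinom_eq_zero_of_lt q n.lt_succ_self]; simp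

lemma qInt_mul_qBinom_succ {n j : ℕ} (h : j ≤ n) :
    qInt q (j + 1) * qBinom q n (j + 1) = qInt q (n - j) * qBinom q n j := by
  induction n generalizing j with
  | zero =>
    obtain rfl : j = 0 := by omega
    simp [qBinom, qInt_zero]
  | succ n ih =>
    cases j with
    | zero =>
      have h1 := ih (Nat.zero_le n)
      have h2 := qInt_add q 1 n
      rw [add_comm 1 n] at h2
      simp only [qBinom_zero_right, qBinom_succ_succ, qInt_one, zero_add, Nat.sub_zero] at h1 h2 ⊢
      rw [h2]
      linear_combination q * h1
    | succ j =>
      rcases (by omega : j = n ∨ j + 1 ≤ n) with rfl | hj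
      · rw [qBinom_eq_zero_of_lt q (by omega), Nat.sub_self, qInt_zero]
        simp
      · obtain ⟨c, rfl⟩ := Nat.exists_eq_add_of_le hj
        have h1 := ih (j := j) (by omega)
        have h2 := ih (j := j + 1) (by omega)
        have h3 := qInt_add q (j + 1 + 1) c
        have h4 := qInt_add q (j + 1) (c + 1)
        rw [show j + 1 + c - j = c + 1 by omega] at h1
        rw [show j + 1 + c - (j + 1) = c by omega] at h2
        rw [show j + 1 + 1 + c = j + 1 + (c + 1) by omega] at h3
        rw [show j + 1 + c + 1 - (j + 1) = c + 1 by omega, qBinom_succ_succ,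
          qBinom_succ_succ q _ j]
        linear_combination h1 + q ^ (j + 1 + 1) * h2 +
          qBinom q (j + 1 + c) (j + 1) * (h4 - h3)

lemma qBinom_succ_succ' {n j : ℕ} (h : j ≤ n) :
    qBinom q (n + 1) (j + 1) = q ^ (n - j) * qBinom q n j + qBinom q n (j + 1) := by
  rw [qBinom_succ_succ]
  linear_combination (q - 1) * qInt_mul_qBinom_succ q h +
    qBinom q n (j + 1) * one_sub_mul_qInt q (j + 1) -
    qBinom q n j * one_sub_mul_qInt q (n - j)

lemma qBinom_sub {n j : ℕ} (h : j ≤ n) : qBinom q n (n - j) = qBinom q n j := by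
  induction n generalizing j with
  | zero =>
    obtain rfl : j = 0 := by omega
    rfl
  | succ n ih =>
    cases j with
    | zero => rw [Nat.sub_zero, qBinom_self, qBinom_zero_right]
    | succ j =>
      rcases (by omega : j = n ∨ j + 1 ≤ n) with rfl | hj
      · rw [Nat.sub_self, qBinom_self, qBinom_zero_right]
      · have h1 := ih (j := j) (by omega)
        have h2 := ih hj
        rw [show n + 1 - (j + 1) = n - (j + 1) + 1 by omega, qBinom_succ_succ, h2,
          qBinom_succ_succ' q (by omega : j ≤ n), show n - (j + 1) + 1 = n - j by omega, h1]
        ring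

end Scalars

section Algebra

variable {k A : Type*} [Field k] [Ring A] [Algebra k A]

lemma mul_pow_eq_smul_of_mul_eq_smul {q : k} {a b : A} (h : a * b = q • (b * a)) (n : ℕ) :
    a * b ^ n = q ^ n • (b ^ n * a) := by
  induction n with
  | zero => simp
  | succ n ih =>
    rw [pow_succ, ← mul_assoc, ih, smul_mul_assoc, mul_assoc, h, mul_smul_comm, smul_smul,
      ← pow_succ, mul_assoc]

lemma sq_mul_pow_eq_smul {q : k} {z t : A} (hzt : z * t = q • (t * z)) (n : ℕ) :
    z ^ 2 * t ^ n = q ^ (2 * n) • (t ^ n * z ^ 2) := by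
  have h := mul_pow_eq_smul_of_mul_eq_smul hzt n
  rw [sq, mul_assoc, h, mul_smul_comm, ← mul_assoc, h, smul_mul_assoc, smul_smul, mul_assoc,
    two_mul, pow_add]

lemma mul_pow_of_qWeyl {q lam : k} {x z t : A} (hzt : z * t = q • (t * z))
    (hxt : x * t = q • (t * x) + lam • z ^ 2) (n : ℕ) :
    x * t ^ n = q ^ n • (t ^ n * x) +
      (lam * q ^ (n - 1) * qInt q n) • (t ^ (n - 1) * z ^ 2) := by
  induction n with
  | zero => simp [qInt_zero]
  | succ n ih =>
    have hc : q • (lam * q ^ (n - 1) * qInt q n) • (t * (t ^ (n - 1) * z ^ 2)) =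
        (lam * q ^ n * qInt q n) • (t ^ n * z ^ 2) := by
      cases n with
      | zero => simp [qInt_zero]
      | succ n =>
        rw [Nat.add_sub_cancel, smul_smul, ← mul_assoc t, ← pow_succ']
        congr 1
        ring
    rw [pow_succ', ← mul_assoc, hxt, add_mul, smul_mul_assoc, mul_assoc, ih, smul_mul_assoc,
      sq_mul_pow_eq_smul hzt, mul_add, mul_smul_comm, mul_smul_comm, smul_add, hc,
      Nat.add_sub_cancel, qInt_add, qInt_one, ← mul_assoc, ← pow_succ']
    module

/-- The degree `n` polynomial `∑ₘ C(n,2m)_q ν(2m) t^(n-2m) z^(2m)`. -/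
def qHermite (q lam : k) (z t : A) (n : ℕ) : A :=
  ∑ m ∈ Finset.range (n + 1),
    (qBinom q n (2 * m) * nuSeq₀ q lam (2 * m)) • (t ^ (n - 2 * m) * z ^ (2 * m))

/-- The defect of `q`-commutation between `x` and `qHermite q lam z t n`. -/
def qHermiteDefect (q lam : k) (z t : A) (n : ℕ) : A :=
  ∑ m ∈ Finset.range (n + 1),
    (qBinom q n (2 * m) * nuSeq₀ q lam (2 * m) *
      (lam * q ^ (n - 2 * m - 1) * qInt q (n - 2 * m))) •
        (t ^ (n - 2 * m - 1) * z ^ (2 * m + 2))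

lemma qHermite_eq_sum_range (q lam : k) (z t : A) (n : ℕ) {N : ℕ} (hN : n / 2 < N) :
    qHermite q lam z t n = ∑ m ∈ Finset.range N,
      (qBinom q n (2 * m) * nuSeq₀ q lam (2 * m)) • (t ^ (n - 2 * m) * z ^ (2 * m)) := by
  have key : ∀ M, n / 2 < M → ∑ m ∈ Finset.range (n / 2 + 1),
      (qBinom q n (2 * m) * nuSeq₀ q lam (2 * m)) • (t ^ (n - 2 * m) * z ^ (2 * m)) =
      ∑ m ∈ Finset.range M,
      (qBinom q n (2 * m) * nuSeq₀ q lam (2 * m)) • (t ^ (n - 2 * m) * z ^ (2 * m)) := by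
    intro M hM
    refine Finset.sum_subset (Finset.range_subset_range.2 hM) fun m _ hm => ?_
    rw [Finset.mem_range] at hm
    rw [qBinom_eq_zero_of_lt q (by omega), zero_mul, zero_smul]
  rw [qHermite, ← key _ (by omega), key N hN]

lemma qHermite_eq_sum_qBinom_sub (q lam : k) (z t : A) (n : ℕ) :
    qHermite q lam z t n = ∑ m ∈ Finset.range (n / 2 + 1),
      (qBinom q n (n - 2 * m) * nuSeq₀ q lam (2 * m)) • (t ^ (n - 2 * m) * z ^ (2 * m)) := by
  rw [qHermite_eq_sum_range q lam z t n (n / 2).lt_succ_self]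
  refine Finset.sum_congr rfl fun m hm => ?_
  rw [Finset.mem_range] at hm
  rw [qBinom_sub q (by omega)]

lemma qHermite_zero (q lam : k) (z t : A) : qHermite q lam z t 0 = 1 := by
  simp [qHermite, qBinom, nuSeq₀]

lemma qHermite_succ (q lam : k) (z t : A) (n : ℕ) :
    qHermite q lam z t (n + 1) = t * qHermite q lam z t n + qHermiteDefect q lam z t n := by
  rw [qHermite_eq_sum_range q lam z t n (by omega : n / 2 < n + 1 + 1), qHermite,
    qHermiteDefect, Finset.sum_range_succ', Finset.sum_range_succ' _ (n + 1), mul_add,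
    Finset.mul_sum, add_right_comm, ← Finset.sum_add_distrib]
  congr 1
  · refine Finset.sum_congr rfl fun m _ => ?_
    rcases lt_or_ge (2 * m) n with h | h
    · have h1 := qInt_mul_qBinom_succ q h.le
      have hcoef : qBinom q (n + 1) (2 * (m + 1)) * nuSeq₀ q lam (2 * (m + 1)) =
          qBinom q n (2 * (m + 1)) * nuSeq₀ q lam (2 * (m + 1)) +
          qBinom q n (2 * m) * nuSeq₀ q lam (2 * m) *
            (lam * q ^ (n - 2 * m - 1) * qInt q (n - 2 * m)) := by
        rw [show 2 * (m + 1) = 2 * m + 1 + 1 by ring, qBinom_succ_succ' q h, nuSeq₀,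
          show n - (2 * m + 1) = n - 2 * m - 1 by omega]
        linear_combination
          q ^ (n - 2 * m - 1) * lam * nuSeq₀ q lam (2 * m) * h1
      have hmul : (qBinom q n (2 * (m + 1)) * nuSeq₀ q lam (2 * (m + 1))) •
            (t * (t ^ (n - 2 * (m + 1)) * z ^ (2 * (m + 1)))) =
          (qBinom q n (2 * (m + 1)) * nuSeq₀ q lam (2 * (m + 1))) •
            (t ^ (n - 2 * m - 1) * z ^ (2 * m + 2)) := by
        rcases lt_or_ge n (2 * (m + 1)) with h' | h'
        · simp [qBinom_eq_zero_of_lt q h']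
        · rw [← mul_assoc, ← pow_succ', show n - 2 * (m + 1) + 1 = n - 2 * m - 1 by omega,
            mul_add_one]
      rw [hcoef, add_smul, mul_smul_comm, hmul,
        show n + 1 - 2 * (m + 1) = n - 2 * m - 1 by omega, mul_add_one]
    · rw [qBinom_eq_zero_of_lt q (by omega : n + 1 < 2 * (m + 1)),
        qBinom_eq_zero_of_lt q (by omega : n < 2 * (m + 1)), Nat.sub_eq_zero_of_le h, qInt_zero]
      simp
  · simp [qBinom_zero_right, pow_succ']

lemma mul_qHermite {q lam : k} {x z t : A} (hxz : x * z = q • (z * x))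
    (hzt : z * t = q • (t * z)) (hxt : x * t = q • (t * x) + lam • z ^ 2) (n : ℕ) :
    x * qHermite q lam z t n =
      q ^ n • (qHermite q lam z t n * x) + qHermiteDefect q lam z t n := by
  rw [qHermite, qHermiteDefect, Finset.mul_sum, Finset.sum_mul, Finset.smul_sum,
    ← Finset.sum_add_distrib]
  refine Finset.sum_congr rfl fun m _ => ?_
  rcases lt_or_ge n (2 * m) with h | h
  · simp [qBinom_eq_zero_of_lt q h]
  · obtain ⟨c, rfl⟩ := Nat.exists_eq_add_of_le h
    rw [Nat.add_sub_cancel_left, mul_smul_comm, ← mul_assoc, mul_pow_of_qWeyl hzt hxt, add_mul,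
      smul_mul_assoc, smul_mul_assoc, mul_assoc (t ^ c),
      mul_pow_eq_smul_of_mul_eq_smul hxz, mul_smul_comm, mul_assoc _ (z ^ 2), ← pow_add,
      add_comm 2 (2 * m), smul_mul_assoc, mul_assoc (t ^ c), pow_add q]
    module

lemma add_pow_eq_sum_qHermite {q lam : k} {x z t : A} (hxz : x * z = q • (z * x))
    (hzt : z * t = q • (t * z)) (hxt : x * t = q • (t * x) + lam • z ^ 2) (n : ℕ) :
    (x + t) ^ n = ∑ i ∈ Finset.range (n + 1),
      qBinom q n i • (qHermite q lam z t i * x ^ (n - i)) := by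
  induction n with
  | zero => simp [qHermite_zero, qBinom]
  | succ n ih =>
    have hstep : ∀ i ∈ Finset.range (n + 1),
        (x + t) * (qBinom q n i • (qHermite q lam z t i * x ^ (n - i))) =
        qBinom q n i • (qHermite q lam z t (i + 1) * x ^ (n - i)) +
          (q ^ i * qBinom q n i) • (qHermite q lam z t i * x ^ (n + 1 - i)) := by
      intro i hi
      rw [Finset.mem_range] at hi
      rw [show n + 1 - i = n - i + 1 by omega, qHermite_succ, pow_succ', mul_smul_comm,
        ← mul_assoc, add_mul x t, mul_qHermite hxz hzt hxt, ← mul_assoc _ x]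
      simp only [add_mul, smul_mul_assoc]
      module
    have hlast : ∑ i ∈ Finset.range (n + 1),
          (q ^ i * qBinom q n i) • (qHermite q lam z t i * x ^ (n + 1 - i)) =
        ∑ i ∈ Finset.range (n + 1 + 1),
          (q ^ i * qBinom q n i) • (qHermite q lam z t i * x ^ (n + 1 - i)) := by
      rw [Finset.sum_range_succ _ (n + 1), qBinom_eq_zero_of_lt q n.lt_succ_self]
      simp
    rw [pow_succ', ih, Finset.mul_sum, Finset.sum_congr rfl hstep, Finset.sum_add_distrib, hlast,
      Finset.sum_range_succ' _ (n + 1), Finset.sum_range_succ' _ (n + 1), ← add_assoc,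
      ← Finset.sum_add_distrib]
    congr 1
    · refine Finset.sum_congr rfl fun i _ => ?_
      rw [Nat.add_sub_add_right, qBinom_succ_succ, add_smul]
    · simp [qBinom_zero_right]

end Algebra

theorem q_binomial_b_zero {k A : Type*} [Field k] [Ring A] [Algebra k A]
    (q : k) (hq : q ≠ 0) (lam : k) (x z t : A)
    (hxz : x * z = q • (z * x)) (hzt : z * t = q • (t * z))
    (hxt : x * t = q • (t * x) + lam • z ^ 2) (n : ℕ) :
    (x + t) ^ n =
      ∑ i ∈ Finset.range (n + 1), ∑ m ∈ Finset.range (i / 2 + 1),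
        (qBinom q n i * qBinom q i (i - 2 * m) * nuSeq₀ q lam (2 * m)) •
          (t ^ (i - 2 * m) * z ^ (2 * m) * x ^ (n - i)) := by
  rw [add_pow_eq_sum_qHermite hxz hzt hxt]
  refine Finset.sum_congr rfl fun i _ => ?_
  rw [qHermite_eq_sum_qBinom_sub, Finset.sum_mul, Finset.smul_sum]
  refine Finset.sum_congr rfl fun m _ => ?_
  rw [smul_mul_assoc, smul_smul, mul_assoc (qBinom q n i)]
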